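/- The semantic λ-calculus is a monad: let Λ X := Quotient of term X by the βη-equivalence lcr. Then subst descends to a well-defined operation subst̄ : (X → Λ Y) → Λ X → Λ Y, and Λ with unit x ↦ ⟦var x⟧ and bind subst̄ satisfies the three monad laws; moreover the projection term X → Λ X, x ↦ ⟦x⟧, is a morphism of monads (it preserves unit and bind). -/

import Mathlib

universe u

/-- Untyped λ-terms with free variables in `X`, in the nested-datatype
(locally nameless / de Bruijn) encoding. -/
inductive term : Type u → Type (u + 1)
  | var {X : Type u} : X → term X
  | app {X : Type u} : term X → term X → term X
  | abs {X : Type u} : term (Option X) → term X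

/-- Renaming of free variables. -/
def fct {X Y : Type u} (f : X → Y) : term X → term Y
  | .var x => .var (f x)
  | .app t u => .app (fct f t) (fct f u)
  | .abs t => .abs (fct (Option.map f) t)

/-- Weakening. -/
def shift {X : Type u} (t : term X) : term (Option X) :=
  fct some t

def tcomm {X Y : Type u} (f : X → term Y) : Option X → term (Option Y)
  | some a => shift (f a)
  | none => .var none

/-- Simultaneous substitution of free variables. -/
def subst {X Y : Type u} (f : X → term Y) : term X → term Y
  | .var x => f x
  | .app t u => .app (subst f t) (subst f u)
  | .abs t => .abs (subst (tcomm f) t)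

/-- The map sending `none` to `u` and `some a` to `var a`;
`t[u] := subst (sub1 u) t`. -/
def sub1 {X : Type u} (u : term X) : Option X → term X
  | none => u
  | some a => .var a

/-- βη-equivalence on λ-terms. -/
inductive lcr : {X : Type u} → term X → term X → Prop
  | var {X : Type u} (a : X) : lcr (.var a) (.var a)
  | app {X : Type u} {x₁ x₂ y₁ y₂ : term X} :
      lcr x₁ x₂ → lcr y₁ y₂ → lcr (.app x₁ y₁) (.app x₂ y₂)
  | abs {X : Type u} {x y : term (Option X)} : lcr x y → lcr (.abs x) (.abs y)
  | beta {X : Type u} (t : term (Option X)) (u : term X) :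
      lcr (.app (.abs t) u) (subst (sub1 u) t)
  | eta {X : Type u} (t : term X) : lcr (.abs (.app (shift t) (.var none))) t
  | sym {X : Type u} {x y : term X} : lcr y x → lcr x y
  | trans {X : Type u} {x y z : term X} : lcr x y → lcr y z → lcr x z

/-- The semantic λ-calculus: λ-terms modulo βη-equivalence. -/
def Lam (X : Type u) : Type (u + 1) := Quot (@lcr.{u} X)

def lmk {X : Type u} : term X → Lam X := Quot.mk _

theorem fct_fct {X : Type u} (t : term X) :
    ∀ {Y Z : Type u} (f : X → Y) (g : Y → Z), fct g (fct f t) = fct (g ∘ f) t := by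
  induction t with
  | var x => intros; rfl
  | app t s iht ihs => intros; simp only [fct, iht, ihs]
  | abs t ih => intros; simp only [fct, ih, Option.map_comp_map]

theorem fct_map_shift {X Y : Type u} (f : X → Y) (t : term X) :
    fct (Option.map f) (shift t) = shift (fct f t) := by
  simp only [shift, fct_fct]
  rfl

theorem tcomm_comp_map {X Y Z : Type u} (f : X → Y) (g : Y → term Z) :
    tcomm g ∘ Option.map f = tcomm (g ∘ f) := by
  funext x
  cases x <;> rfl

theorem subst_fct {X : Type u} (t : term X) :
    ∀ {Y Z : Type u} (f : X → Y) (g : Y → term Z), subst g (fct f t) = subst (g ∘ f) t := by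
  induction t with
  | var x => intros; rfl
  | app t s iht ihs => intros; simp only [fct, subst, iht, ihs]
  | abs t ih => intros; simp only [fct, subst, ih, tcomm_comp_map]

theorem fct_comp_tcomm {X Y Z : Type u} (f : X → term Y) (g : Y → Z) :
    fct (Option.map g) ∘ tcomm f = tcomm (fct g ∘ f) := by
  funext x
  cases x with
  | none => rfl
  | some a => exact fct_map_shift g (f a)

theorem fct_subst {X : Type u} (t : term X) :
    ∀ {Y Z : Type u} (f : X → term Y) (g : Y → Z),
      fct g (subst f t) = subst (fct g ∘ f) t := by
  induction t with
  | var x => intros; rfl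
  | app t s iht ihs => intros; simp only [fct, subst, iht, ihs]
  | abs t ih => intros; simp only [fct, subst, ih, fct_comp_tcomm]

theorem subst_tcomm_shift {X Y : Type u} (f : X → term Y) (t : term X) :
    subst (tcomm f) (shift t) = shift (subst f t) := by
  simp only [shift, subst_fct, fct_subst]
  rfl

theorem subst_comp_tcomm {X Y Z : Type u} (f : X → term Y) (g : Y → term Z) :
    subst (tcomm g) ∘ tcomm f = tcomm (subst g ∘ f) := by
  funext x
  cases x with
  | none => rfl
  | some a => exact subst_tcomm_shift g (f a)

theorem subst_subst {X : Type u} (t : term X) :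
    ∀ {Y Z : Type u} (f : X → term Y) (g : Y → term Z),
      subst g (subst f t) = subst (subst g ∘ f) t := by
  induction t with
  | var x => intros; rfl
  | app t s iht ihs => intros; simp only [subst, iht, ihs]
  | abs t ih => intros; simp only [subst, ih, subst_comp_tcomm]

theorem tcomm_var {X : Type u} : tcomm (term.var : X → term X) = term.var := by
  funext x
  cases x <;> rfl

theorem subst_var {X : Type u} (t : term X) : subst term.var t = t := by
  induction t with
  | var x => rfl
  | app t s iht ihs => simp only [subst, iht, ihs]
  | abs t ih => simp only [subst, tcomm_var, ih]

theorem subst_sub1_shift {X : Type u} (u t : term X) : subst (sub1 u) (shift t) = t := by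
  rw [shift, subst_fct]
  exact subst_var t

theorem subst_subst_sub1 {X Y : Type u} (f : X → term Y) (t : term (Option X)) (u : term X) :
    subst f (subst (sub1 u) t) = subst (sub1 (subst f u)) (subst (tcomm f) t) := by
  simp only [subst_subst]
  congr 1
  funext x
  cases x with
  | none => rfl
  | some a => exact (subst_sub1_shift _ (f a)).symm

theorem lcr.refl {X : Type u} (t : term X) : lcr t t :=
  .trans (.sym (.eta t)) (.eta t)

theorem lcr.subst_left {X : Type u} {s t : term X} (h : lcr s t) :
    ∀ {Y : Type u} (f : X → term Y), lcr (subst f s) (subst f t) := by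
  induction h with
  | var a => intros; exact .refl _
  | app _ _ ih₁ ih₂ => intro _ f; exact .app (ih₁ f) (ih₂ f)
  | abs _ ih => intro _ f; exact .abs (ih _)
  | beta t u => intro _ f; rw [subst_subst_sub1]; exact .beta _ _
  | eta t =>
    intro _ f
    simp only [subst, subst_tcomm_shift]
    exact .eta _
  | sym _ ih => intro _ f; exact .sym (ih f)
  | trans _ _ ih₁ ih₂ => intro _ f; exact .trans (ih₁ f) (ih₂ f)

theorem lcr.shift {X : Type u} {s t : term X} (h : lcr s t) : lcr (shift s) (shift t) := by
  have key (r : term X) : _root_.shift r = subst (fun x => .var (some x)) r := by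
    conv_lhs => rw [_root_.shift, ← subst_var r, fct_subst]
    rfl
  rw [key, key]
  exact h.subst_left _

theorem lcr.subst_right {X : Type u} (t : term X) :
    ∀ {Y : Type u} {f g : X → term Y}, (∀ x, lcr (f x) (g x)) →
      lcr (subst f t) (subst g t) := by
  induction t with
  | var x => intro _ f g h; exact h x
  | app t s iht ihs => intro _ f g h; exact .app (iht h) (ihs h)
  | abs t ih =>
    intro _ f g h
    refine .abs (ih fun x => ?_)
    cases x with
    | none => exact .refl _
    | some a => exact (h a).shift

theorem lmk_eq_iff {X : Type u} {s t : term X} : lmk s = lmk t ↔ lcr s t :=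
  Quot.eq.trans (Equivalence.eqvGen_iff ⟨lcr.refl, lcr.sym, lcr.trans⟩)

theorem lmk_out {X : Type u} (t : Lam X) : lmk (Quot.out t) = t :=
  Quot.out_eq t

/-- Substitution of semantic λ-terms for the free variables of a semantic λ-term. -/
noncomputable def Lam.bind {X Y : Type u} (f : X → Lam Y) : Lam X → Lam Y :=
  Quot.lift (fun t => lmk (subst (fun x => Quot.out (f x)) t))
    fun _ _ h => lmk_eq_iff.2 (h.subst_left _)

theorem Lam.bind_lmk {X Y : Type u} (f : X → term Y) (t : term X) :
    Lam.bind (fun x => lmk (f x)) (lmk t) = lmk (subst f t) :=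
  lmk_eq_iff.2 (lcr.subst_right t fun _ => lmk_eq_iff.1 (lmk_out _))

theorem Lam.exists_rep {X Y : Type u} (f : X → Lam Y) :
    ∃ f' : X → term Y, f = fun x => lmk (f' x) :=
  ⟨fun x => Quot.out (f x), funext fun x => (lmk_out (f x)).symm⟩

/-- The semantic λ-calculus is a monad: `subst` descends to
a well-defined bind operation `sbind` on `Λ X := term X / βη`, satisfying the
three monad laws with unit `x ↦ ⟦var x⟧`; moreover the projection
`term X → Λ X` is a morphism of monads. -/
theorem Lam_is_monad :
    ∃ sbind : ∀ X Y : Type u, (X → Lam Y) → Lam X → Lam Y,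
      -- `sbind` is the descent of `subst`, so the projection `lmk` is a
      -- morphism of monads (it preserves unit by definition and bind by
      -- the following equation):
      (∀ (X Y : Type u) (f : X → term Y) (x : term X),
        sbind X Y (fun u => lmk (f u)) (lmk x) = lmk (subst f x)) ∧
      -- the three monad laws:
      (∀ (X Y Z : Type u) (f : X → Lam Y) (g : Y → Lam Z) (x : Lam X),
        sbind Y Z g (sbind X Y f x) = sbind X Z (fun u => sbind Y Z g (f u)) x) ∧
      (∀ (X Y : Type u) (f : X → Lam Y) (x : X),
        sbind X Y f (lmk (term.var x)) = f x) ∧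
      (∀ (X : Type u) (x : Lam X),
        sbind X X (fun u => lmk (term.var u)) x = x) := by
  refine ⟨fun _ _ => Lam.bind, fun _ _ => Lam.bind_lmk, ?_, ?_, ?_⟩
  · rintro X Y Z f g ⟨x⟩
    obtain ⟨f, rfl⟩ := Lam.exists_rep f
    obtain ⟨g, rfl⟩ := Lam.exists_rep g
    change Lam.bind _ (Lam.bind _ (lmk x)) = Lam.bind _ (lmk x)
    simp only [Lam.bind_lmk, subst_subst]
    rfl
  · intro X Y f x
    exact lmk_out (f x)
  · rintro X ⟨x⟩
    exact (Lam.bind_lmk _ x).trans (congrArg lmk (subst_var x))
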